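/- Let ν be a numbering of a set X (a partial function ℕ ⇀ X whose image is all of X) and let (ℬ, β) be a Nogina basis for (X, ν). Then the Nogina topology (𝒯, τ) associated to (ℬ, β) makes (X, ν, 𝒯, τ), with the actual inclusion relation as formal inclusion, a Type 1 computable topological space. -/

import Mathlib

namespace T1

/-- `phi e` : the `e`-th partial computable function `ℕ ⇀ ℕ`. -/
def phi (e : ℕ) : ℕ →. ℕ :=
  Nat.Partrec.Code.eval (Denumerable.ofNat Nat.Partrec.Code e)

/-- `W e` : the `e`-th computably enumerable subset of `ℕ`. -/
def W (e : ℕ) : Set ℕ := (phi e).Dom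

/-- A canonical numbering of the rationals. -/
def ratOfNat (k : ℕ) : ℚ := (Encodable.decode (α := ℚ) k).getD 0

/-- `e` is a name of `A ⊆ X` as a `ν`-semi-decidable set (a `ν_SD,m`-name):
`phi e` halts on a `ν`-name exactly when the named point belongs to `A`. -/
def SemiDecName {X : Type*} (ν : ℕ →. X) (A : Set X) (e : ℕ) : Prop :=
  ∀ i x, x ∈ ν i → ((phi e i).Dom ↔ x ∈ A)

/-- `f : X → Y` is `(ν,μ)`-computable. -/
def Computes {X Y : Type*} (ν : ℕ →. X) (μ : ℕ →. Y) (f : X → Y) : Prop :=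
  ∃ F : ℕ →. ℕ, Nat.Partrec F ∧ ∀ n x, x ∈ ν n → ∃ m ∈ F n, f x ∈ μ m

/-- `r` is a formal inclusion relation for the naming relation `β` of a family of
subsets of `X`: reflexive (on names), transitive, and implying actual inclusion. -/
structure IsFormalIncl {X : Type*} (β : ℕ → Set X → Prop) (r : ℕ → ℕ → Prop) : Prop where
  refl : ∀ n A, β n A → r n n
  trans : ∀ a b c, r a b → r b c → r a c
  mono : ∀ n m A B, r n m → β n A → β m B → A ⊆ B

/-- Extension of a formal inclusion relation: a name vs. a sequence of names. -/
def SeqIncl (r : ℕ → ℕ → Prop) (b : ℕ) (s : ℕ → ℕ) : Prop := ∃ k, r b (s k)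

/-- Extension of a formal inclusion relation: sequence vs. sequence. -/
def SeqIncl₂ (r : ℕ → ℕ → Prop) (s t : ℕ → ℕ) : Prop := ∀ p, SeqIncl r (s p) t

/-- The equivalence induced by the extended formal inclusion on sequences. -/
def SeqEquiv (r : ℕ → ℕ → Prop) (s t : ℕ → ℕ) : Prop := SeqIncl₂ r s t ∧ SeqIncl₂ r t s

/-- A Type 1 computable topological space `(X, ν, T, τ, r)`, where `τ` is a
(single-valued) naming relation for open sets and `r` a formal inclusion relation. -/
structure IsCTS {X : Type*} (ν : ℕ →. X) (T : TopologicalSpace X)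
    (τ : ℕ → Set X → Prop) (r : ℕ → ℕ → Prop) : Prop where
  single : ∀ n A B, τ n A → τ n B → A = B
  formal : IsFormalIncl τ r
  isOpen : ∀ n A, τ n A → T.IsOpen A
  generates : T = TopologicalSpace.generateFrom {A | ∃ n, τ n A}
  empty : ∃ n, τ n (∅ : Set X)
  univ : ∃ n, τ n (Set.univ : Set X)
  malcev : ∃ F : ℕ →. ℕ, Nat.Partrec F ∧ ∀ n A, τ n A → ∃ e ∈ F n, SemiDecName ν A e
  union : ∃ U : ℕ →. ℕ, Nat.Partrec U ∧
    (∀ c (s : ℕ → ℕ) (A : ℕ → Set X), (∀ k, s k ∈ phi c k) → (∀ k, τ (s k) (A k)) →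
      ∃ u ∈ U c, τ u (⋃ k, A k) ∧ ∀ k, r (s k) u) ∧
    (∀ c (s : ℕ → ℕ) (A : ℕ → Set X) c' (s' : ℕ → ℕ) (A' : ℕ → Set X),
      (∀ k, s k ∈ phi c k) → (∀ k, τ (s k) (A k)) →
      (∀ k, s' k ∈ phi c' k) → (∀ k, τ (s' k) (A' k)) →
      (∀ p, SeqIncl r (s p) s') →
      ∀ u ∈ U c, ∀ u' ∈ U c', r u u')
  inter : ∃ I : ℕ →. ℕ, Nat.Partrec I ∧
    (∀ n₁ n₂ A₁ A₂, τ n₁ A₁ → τ n₂ A₂ → ∃ u ∈ I (Nat.pair n₁ n₂), τ u (A₁ ∩ A₂)) ∧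
    (∀ n₁ n₂ A₁ A₂ n₁' n₂' A₁' A₂', τ n₁ A₁ → τ n₂ A₂ → τ n₁' A₁' → τ n₂' A₂' →
      r n₁ n₁' → r n₂ n₂' →
      ∀ u ∈ I (Nat.pair n₁ n₂), ∀ u' ∈ I (Nat.pair n₁' n₂'), r u u')

/-- A Type 1 computable topological space with the actual inclusion relation as
formal inclusion (all monotonicity requirements are then automatic and omitted). -/
structure IsCTSIncl {X : Type*} (ν : ℕ →. X) (T : TopologicalSpace X)
    (τ : ℕ → Set X → Prop) : Prop where
  single : ∀ n A B, τ n A → τ n B → A = B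
  isOpen : ∀ n A, τ n A → T.IsOpen A
  generates : T = TopologicalSpace.generateFrom {A | ∃ n, τ n A}
  empty : ∃ n, τ n (∅ : Set X)
  univ : ∃ n, τ n (Set.univ : Set X)
  malcev : ∃ F : ℕ →. ℕ, Nat.Partrec F ∧ ∀ n A, τ n A → ∃ e ∈ F n, SemiDecName ν A e
  union : ∃ U : ℕ →. ℕ, Nat.Partrec U ∧
    ∀ c (s : ℕ → ℕ) (A : ℕ → Set X), (∀ k, s k ∈ phi c k) → (∀ k, τ (s k) (A k)) →
      ∃ u ∈ U c, τ u (⋃ k, A k)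
  inter : ∃ I : ℕ →. ℕ, Nat.Partrec I ∧
    ∀ n₁ n₂ A₁ A₂, τ n₁ A₁ → τ n₂ A₂ → ∃ u ∈ I (Nat.pair n₁ n₂), τ u (A₁ ∩ A₂)

/-- A Nogina basis for `(X, ν)` (with `ν` intended to be a numbering, i.e. onto). -/
structure IsNoginaBasis {X : Type*} (ν : ℕ →. X) (β : ℕ → Set X → Prop) : Prop where
  single : ∀ b B B', β b B → β b B' → B = B'
  semidec : ∃ F : ℕ →. ℕ, Nat.Partrec F ∧ ∀ b B, β b B → ∃ e ∈ F b, SemiDecName ν B e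
  point : ∃ G : ℕ →. ℕ, Nat.Partrec G ∧
    ∀ n x, x ∈ ν n → ∃ b ∈ G n, ∃ B, β b B ∧ x ∈ B
  inter : ∃ H : ℕ →. ℕ, Nat.Partrec H ∧
    ∀ b₁ b₂ B₁ B₂ n x, β b₁ B₁ → β b₂ B₂ → x ∈ ν n → x ∈ B₁ → x ∈ B₂ →
      ∃ b₃ ∈ H (Nat.pair (Nat.pair b₁ b₂) n), ∃ B₃, β b₃ B₃ ∧ x ∈ B₃ ∧ B₃ ⊆ B₁ ∩ B₂

/-- `p = ⟨e₁, e₂⟩` is a name of the open set `O` for the Nogina topology of the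
basis `β`: `e₁` witnesses semi-decidability of `O` and `e₂` computes, from a
`ν`-name of a point of `O`, a basic set containing the point and contained in `O`. -/
def NoginaName {X : Type*} (ν : ℕ →. X) (β : ℕ → Set X → Prop) (p : ℕ) (O : Set X) : Prop :=
  SemiDecName ν O p.unpair.1 ∧
  ∀ n x, x ∈ ν n → x ∈ O → ∃ b ∈ phi p.unpair.2 n, ∃ B, β b B ∧ x ∈ B ∧ B ⊆ O

/-- `i` is a name of `O` as a Lacombe set: `W i ⊆ dom β` and `O` is the union of
the basic sets named by elements of `W i`. -/
def LacombeName {X : Type*} (β : ℕ → Set X → Prop) (i : ℕ) (O : Set X) : Prop :=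
  (∀ k ∈ W i, ∃ B, β k B) ∧ O = ⋃ k ∈ W i, ⋃ B, ⋃ (_ : β k B), B

/-- A Lacombe basis for `(X, ν)`. -/
structure IsLacombeBasis {X : Type*} (ν : ℕ →. X) (β : ℕ → Set X → Prop) : Prop where
  single : ∀ b B B', β b B → β b B' → B = B'
  semidec : ∃ F : ℕ →. ℕ, Nat.Partrec F ∧ ∀ b B, β b B → ∃ e ∈ F b, SemiDecName ν B e
  point : ∀ x : X, ∃ b B, β b B ∧ x ∈ B
  cover : ∃ i, LacombeName β i (Set.univ : Set X)
  inter : ∃ H : ℕ →. ℕ, Nat.Partrec H ∧ ∀ b₁ b₂ B₁ B₂, β b₁ B₁ → β b₂ B₂ →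
    ∃ i ∈ H (Nat.pair b₁ b₂), LacombeName β i (B₁ ∩ B₂)

/-- A Spreen basis for `(X, ν)`, with formal inclusion relation `r`.  Computable
functions with values in `dom(β)^ℕ` are represented by partial computable
functions producing the `k`-th term of the sequence from the pair `⟨input, k⟩`. -/
structure IsSpreenBasis {X : Type*} (ν : ℕ →. X) (β : ℕ → Set X → Prop)
    (r : ℕ → ℕ → Prop) : Prop where
  single : ∀ b B B', β b B → β b B' → B = B'
  formal : IsFormalIncl β r
  semidec : ∃ F : ℕ →. ℕ, Nat.Partrec F ∧ ∀ b B, β b B → ∃ e ∈ F b, SemiDecName ν B e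
  dense : ∀ b B, β b B → B.Nonempty → ∃ n x, x ∈ ν n ∧ x ∈ B
  G1 : ∃ g : ℕ →. ℕ, Nat.Partrec g ∧
    (∀ n x, x ∈ ν n → ∃ s : ℕ → ℕ, (∀ k, s k ∈ g (Nat.pair n k)) ∧
      ∀ k, ∃ B, β (s k) B ∧ x ∈ B) ∧
    (∀ n m x (s t : ℕ → ℕ), x ∈ ν n → x ∈ ν m →
      (∀ k, s k ∈ g (Nat.pair n k)) → (∀ k, t k ∈ g (Nat.pair m k)) → SeqEquiv r s t) ∧
    (∀ x : X, ∃ b B, β b B ∧ x ∈ B ∧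
      ∀ n y, y ∈ ν n → y ∈ B → ∀ s : ℕ → ℕ, (∀ k, s k ∈ g (Nat.pair n k)) → SeqIncl r b s)
  G2 : ∃ g : ℕ →. ℕ, Nat.Partrec g ∧
    (∀ n x b₁ b₂ B₁ B₂, x ∈ ν n → β b₁ B₁ → β b₂ B₂ → x ∈ B₁ → x ∈ B₂ →
      ∃ s : ℕ → ℕ, (∀ k, s k ∈ g (Nat.pair (Nat.pair n (Nat.pair b₁ b₂)) k)) ∧
        ∀ k, ∃ B, β (s k) B ∧ x ∈ B ∧ B ⊆ B₁ ∩ B₂) ∧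
    (∀ n m x b₁ b₂ b₁' b₂' (s t : ℕ → ℕ), x ∈ ν n → x ∈ ν m → r b₁ b₁' → r b₂ b₂' →
      (∀ k, s k ∈ g (Nat.pair (Nat.pair n (Nat.pair b₁ b₂)) k)) →
      (∀ k, t k ∈ g (Nat.pair (Nat.pair m (Nat.pair b₁' b₂')) k)) → SeqIncl₂ r s t) ∧
    (∀ b₁ b₂ B₁ B₂, β b₁ B₁ → β b₂ B₂ → ∀ x, x ∈ B₁ → x ∈ B₂ →
      ∃ b₃ B₃, β b₃ B₃ ∧ x ∈ B₃ ∧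
        ∀ m y, y ∈ ν m → y ∈ B₃ → ∀ s : ℕ → ℕ,
          (∀ k, s k ∈ g (Nat.pair (Nat.pair m (Nat.pair b₁ b₂)) k)) → SeqIncl r b₃ s)

/-- `p = ⟨n, m⟩` is a name of the open set `O` for the Spreen topology of the
Spreen basis `(β, r)`. -/
def SpreenName {X : Type*} (ν : ℕ →. X) (β : ℕ → Set X → Prop) (r : ℕ → ℕ → Prop)
    (p : ℕ) (O : Set X) : Prop :=
  SemiDecName ν O p.unpair.1 ∧
  (∀ n x, x ∈ ν n → x ∈ O → ∃ s : ℕ → ℕ,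
      (∀ k, s k ∈ phi p.unpair.2 (Nat.pair n k)) ∧
      ∀ k, ∃ B, β (s k) B ∧ x ∈ B ∧ B ⊆ O) ∧
  (∀ n m x (s t : ℕ → ℕ), x ∈ ν n → x ∈ ν m → x ∈ O →
      (∀ k, s k ∈ phi p.unpair.2 (Nat.pair n k)) →
      (∀ k, t k ∈ phi p.unpair.2 (Nat.pair m k)) → SeqEquiv r s t) ∧
  (∀ x, x ∈ O → ∃ b B, β b B ∧ x ∈ B ∧
      ∀ n y, y ∈ ν n → y ∈ B → ∀ s : ℕ → ℕ,
        (∀ k, s k ∈ phi p.unpair.2 (Nat.pair n k)) → SeqIncl r b s)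

/-- The extension of the formal inclusion relation `r` to names of Spreen open sets. -/
def SpreenTauIncl {X : Type*} (ν : ℕ →. X) (r : ℕ → ℕ → Prop) (p q : ℕ) : Prop :=
  ∀ n ∈ ν.Dom, (phi p.unpair.1 n).Dom →
    (phi q.unpair.1 n).Dom ∧
    ∀ s t : ℕ → ℕ, (∀ k, s k ∈ phi p.unpair.2 (Nat.pair n k)) →
      (∀ k, t k ∈ phi q.unpair.2 (Nat.pair n k)) → SeqIncl₂ r s t

/-- A partial computable translation of Spreen names of open sets for the basis
`(β₁, r₁)` into Spreen names for the basis `(β₂, r₂)`, increasing with respect to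
the extended formal inclusion relations. -/
def SpreenTopTrans {X : Type*} (ν : ℕ →. X) (β₁ : ℕ → Set X → Prop) (r₁ : ℕ → ℕ → Prop)
    (β₂ : ℕ → Set X → Prop) (r₂ : ℕ → ℕ → Prop) : Prop :=
  ∃ h : ℕ →. ℕ, Nat.Partrec h ∧
    (∀ p O, SpreenName ν β₁ r₁ p O → ∃ q ∈ h p, SpreenName ν β₂ r₂ q O) ∧
    (∀ p p' O O', SpreenName ν β₁ r₁ p O → SpreenName ν β₁ r₁ p' O' →
      SpreenTauIncl ν r₁ p p' → ∀ q ∈ h p, ∀ q' ∈ h p', SpreenTauIncl ν r₂ q q')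

/-- Effective continuity between computable topological spaces, with the actual
inclusion relations as formal inclusions. -/
def EffContinuous {X Y : Type*} (T₁ : TopologicalSpace X) (T₂ : TopologicalSpace Y)
    (τ₁ : ℕ → Set X → Prop) (τ₂ : ℕ → Set Y → Prop) (f : X → Y) : Prop :=
  (@Continuous X Y T₁ T₂ f) ∧
  ∃ h : ℕ →. ℕ, Nat.Partrec h ∧ ∀ n O, τ₂ n O → ∃ m ∈ h n, τ₁ m (f ⁻¹' O)

/-- Effective continuity between computable topological spaces with formal
inclusion relations `r₁`, `r₂` on names of open sets. -/
def EffContinuousF {X Y : Type*} (T₁ : TopologicalSpace X) (T₂ : TopologicalSpace Y)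
    (τ₁ : ℕ → Set X → Prop) (τ₂ : ℕ → Set Y → Prop)
    (r₁ r₂ : ℕ → ℕ → Prop) (f : X → Y) : Prop :=
  (@Continuous X Y T₁ T₂ f) ∧
  ∃ h : ℕ →. ℕ, Nat.Partrec h ∧
    (∀ n O, τ₂ n O → ∃ m ∈ h n, τ₁ m (f ⁻¹' O)) ∧
    (∀ n₁ n₂ O₁ O₂, τ₂ n₁ O₁ → τ₂ n₂ O₂ → r₂ n₁ n₂ →
      ∀ m₁ ∈ h n₁, ∀ m₂ ∈ h n₂, r₁ m₁ m₂)

/-- `e` is a Cauchy name (`c_ℝ`-name) of the real number `x`. -/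
def CRealName (e : ℕ) (x : ℝ) : Prop :=
  ∀ n : ℕ, ∃ m ∈ phi e n, |((ratOfNat m : ℚ) : ℝ) - x| < (2 : ℝ) ^ (-(n : ℤ))

/-- `e` is a left (lower) name (`c_↗`-name) of the real number `x`: it computes a
nondecreasing sequence of rationals below `x` converging to `x`. -/
def LRealName (e : ℕ) (x : ℝ) : Prop :=
  ∃ s : ℕ → ℕ, (∀ n, s n ∈ phi e n) ∧
    (Monotone fun n => ratOfNat (s n)) ∧
    (∀ n, ((ratOfNat (s n) : ℚ) : ℝ) < x) ∧
    Filter.Tendsto (fun n => ((ratOfNat (s n) : ℚ) : ℝ)) Filter.atTop (nhds x)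

/-- `(X, ν, d)` is a (non-necessarily effectively separable) computable metric
space: the computable points are dense and the metric is `(ν×ν, c_ℝ)`-computable. -/
structure IsCMS {X : Type*} [MetricSpace X] (ν : ℕ →. X) : Prop where
  dense : Dense {x : X | ∃ n, x ∈ ν n}
  dist_comp : ∃ F : ℕ →. ℕ, Nat.Partrec F ∧
    ∀ n m x y, x ∈ ν n → y ∈ ν m → ∃ e ∈ F (Nat.pair n m), CRealName e (dist x y)

/-- The natural numbering of the open balls of a computable metric space, centered
at computable points with computable radii: `⟨n, m⟩` names `B(ν n, c_ℝ m)`. -/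
def ballName {X : Type*} [MetricSpace X] (ν : ℕ →. X) (p : ℕ) (B : Set X) : Prop :=
  ∃ x r, x ∈ ν p.unpair.1 ∧ CRealName p.unpair.2 r ∧ B = Metric.ball x r

/-- The natural formal inclusion relation on names of balls:
`(x, r₁) ⊆̊ (y, r₂)` iff `d(x, y) + r₁ ≤ r₂`. -/
def ballIncl {X : Type*} [MetricSpace X] (ν : ℕ →. X) (p q : ℕ) : Prop :=
  ∃ x y r s, x ∈ ν p.unpair.1 ∧ y ∈ ν q.unpair.1 ∧
    CRealName p.unpair.2 r ∧ CRealName q.unpair.2 s ∧ dist x y + r ≤ s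

/-- `f` is effectively metric continuous: from a name of a point `x` and a name of
`ε > 0` one can compute a name of some `η > 0` witnessing continuity at `x`. -/
def EffMetricContinuous {X Y : Type*} [MetricSpace X] [MetricSpace Y]
    (ν : ℕ →. X) (f : X → Y) : Prop :=
  ∃ H : ℕ →. ℕ, Nat.Partrec H ∧
    ∀ n x e ε, x ∈ ν n → CRealName e ε → (0:ℝ) < ε →
      ∃ m ∈ H (Nat.pair n e), ∃ η : ℝ, CRealName m η ∧ 0 < η ∧
        ∀ y : X, dist x y < η → dist (f x) (f y) < ε

/-- `(X, ν, d)` admits an algorithm of passage to the limit. -/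
def HasLimitAlg {X : Type*} [MetricSpace X] (ν : ℕ →. X) : Prop :=
  ∃ L : ℕ →. ℕ, Nat.Partrec L ∧
    ∀ c (s : ℕ → ℕ) (xs : ℕ → X) (x : X),
      (∀ k, s k ∈ phi c k) → (∀ k, xs k ∈ ν (s k)) →
      (∀ k m, k < m → dist (xs k) (xs m) < (2 : ℝ) ^ (-(k : ℤ))) →
      Filter.Tendsto xs Filter.atTop (nhds x) →
      ∃ p ∈ L c, x ∈ ν p


theorem phi_partrec : Partrec₂ phi :=
  Nat.Partrec.Code.eval_part.comp
    ((Computable.ofNat Nat.Partrec.Code).comp Computable.fst) Computable.snd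

theorem exists_phi_eq {f : ℕ → ℕ →. ℕ} (hf : Partrec₂ f) :
    ∃ h : ℕ → ℕ, Computable h ∧ ∀ a n, phi (h a) n = f a n := by
  obtain ⟨c, hc⟩ := Nat.Partrec.Code.exists_code.1 (Partrec.nat_iff.1 (Partrec₂.unpaired.2 hf))
  refine ⟨fun a => Encodable.encode (c.curry a), ?_, fun a n => ?_⟩
  · exact Computable.encode.comp
      (Nat.Partrec.Code.primrec₂_curry.to_comp.comp (Computable.const c) Computable.id)
  · simp [phi, Nat.Partrec.Code.eval_curry, hc, Nat.unpaired]

/-- Dovetailing: a partial computable search for an index at which `f a` halts. -/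
theorem exists_halting_search {f : ℕ → ℕ →. ℕ} (hf : Partrec₂ f) :
    ∃ g : ℕ →. ℕ, Partrec g ∧
      ∀ a, (∀ k ∈ g a, (f a k).Dom) ∧ ((∃ k, (f a k).Dom) → (g a).Dom) := by
  obtain ⟨c, hc⟩ := Nat.Partrec.Code.exists_code.1 (Partrec.nat_iff.1 (Partrec₂.unpaired.2 hf))
  have hev : ∀ a k, c.eval (Nat.pair a k) = f a k := fun a k => by simp [hc, Nat.unpaired]
  refine ⟨fun a => Nat.rfindOpt fun m =>
    (Nat.Partrec.Code.evaln m.unpair.1 c (Nat.pair a m.unpair.2)).map fun _ => m.unpair.2,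
    ?_, fun a => ⟨fun k hk => ?_, ?_⟩⟩
  · refine Partrec.rfindOpt (Computable.option_map ?_ ?_)
    · exact Nat.Partrec.Code.primrec_evaln.to_comp.comp
        (((Computable.fst.comp (Computable.unpair.comp Computable.snd)).pair
          (Computable.const c)).pair
          (Primrec₂.natPair.to_comp.comp Computable.fst
            (Computable.snd.comp (Computable.unpair.comp Computable.snd))))
    · exact (Computable.snd.comp
        (Computable.unpair.comp (Computable.snd.comp Computable.fst))).to₂
  · obtain ⟨m, hm⟩ := Nat.rfindOpt_spec hk
    obtain ⟨y, hy, rfl⟩ := Option.map_eq_some_iff.1 hm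
    rw [← hev]
    exact Part.dom_iff_mem.2 ⟨y, Nat.Partrec.Code.evaln_sound hy⟩
  · rintro ⟨k, hk⟩
    rw [← hev] at hk
    obtain ⟨y, hy⟩ := Part.dom_iff_mem.1 hk
    obtain ⟨t, ht⟩ := Nat.Partrec.Code.evaln_complete.1 hy
    refine Nat.rfindOpt_dom.2 ⟨Nat.pair t k, k, ?_⟩
    simp only [Nat.unpair_pair]
    exact Option.map_eq_some_iff.2 ⟨y, ht, rfl⟩

section Nogina

variable {X : Type*} {ν : ℕ →. X} {β : ℕ → Set X → Prop}

theorem SemiDecName.subset (hν : ∀ x : X, ∃ n, x ∈ ν n) {A B : Set X} {e : ℕ}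
    (hA : SemiDecName ν A e) (hB : SemiDecName ν B e) : A ⊆ B := fun x hx => by
  obtain ⟨n, hn⟩ := hν x
  exact (hB n x hn).1 ((hA n x hn).2 hx)

theorem NoginaName.isOpen (hν : ∀ x : X, ∃ n, x ∈ ν n) {p : ℕ} {O : Set X}
    (h : NoginaName ν β p O) :
    (TopologicalSpace.generateFrom {B | ∃ b, β b B}).IsOpen O := by
  let _ : TopologicalSpace X := TopologicalSpace.generateFrom {B | ∃ b, β b B}
  refine isOpen_iff_forall_mem_open.2 fun x hx => ?_
  obtain ⟨n, hn⟩ := hν x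
  obtain ⟨b, -, B, hB, hxB, hBO⟩ := h.2 n x hn hx
  exact ⟨B, hBO, TopologicalSpace.isOpen_generateFrom_of_mem ⟨b, hB⟩, hxB⟩

theorem IsNoginaBasis.exists_name_of_basic (hβ : IsNoginaBasis ν β) {b : ℕ} {B : Set X}
    (hB : β b B) : ∃ p, NoginaName ν β p B := by
  obtain ⟨F, -, hF⟩ := hβ.semidec
  obtain ⟨e, -, he⟩ := hF b B hB
  obtain ⟨h, -, hh⟩ := exists_phi_eq (f := fun b _ => Part.some b) Computable.fst
  refine ⟨Nat.pair e (h b), by simpa using he, fun n x _ hx => ⟨b, ?_, B, hB, hx, subset_rfl⟩⟩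
  simp [hh]

theorem exists_noginaName_empty (ν : ℕ →. X) (β : ℕ → Set X → Prop) :
    ∃ p, NoginaName ν β p (∅ : Set X) := by
  obtain ⟨h, -, hh⟩ := exists_phi_eq (f := fun _ _ => Part.none) Partrec.none
  refine ⟨Nat.pair (h 0) 0, fun n x _ => ?_, fun n x _ hx => hx.elim⟩
  simp [hh]

theorem IsNoginaBasis.exists_name_univ (hβ : IsNoginaBasis ν β) :
    ∃ p, NoginaName ν β p (Set.univ : Set X) := by
  obtain ⟨G, hG, hGp⟩ := hβ.point
  obtain ⟨h, -, hh⟩ := exists_phi_eq (f := fun _ n => G n)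
    ((Partrec.nat_iff.2 hG).comp Computable.snd)
  refine ⟨Nat.pair (h 0) (h 0), fun n x hx => ?_, fun n x hx _ => ?_⟩
  · obtain ⟨b, hb, -⟩ := hGp n x hx
    simpa [hh] using Part.dom_iff_mem.2 ⟨b, hb⟩
  · obtain ⟨b, hb, B, hB, hxB⟩ := hGp n x hx
    exact ⟨b, by simpa [hh] using hb, B, hB, hxB, Set.subset_univ B⟩

theorem exists_noginaName_iUnion (ν : ℕ →. X) (β : ℕ → Set X → Prop) :
    ∃ U : ℕ →. ℕ, Nat.Partrec U ∧
      ∀ c (s : ℕ → ℕ) (A : ℕ → Set X), (∀ k, s k ∈ phi c k) →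
        (∀ k, NoginaName ν β (s k) (A k)) → ∃ u ∈ U c, NoginaName ν β u (⋃ k, A k) := by
  obtain ⟨g, hg, hgs⟩ := exists_halting_search
    (f := fun a k => (phi a.unpair.1 k).bind fun s => phi s.unpair.1 a.unpair.2) <| by
      refine Partrec.bind (phi_partrec.comp
        (Computable.fst.comp (Computable.unpair.comp Computable.fst)) Computable.snd) ?_
      exact (phi_partrec.comp
        (Computable.fst.comp (Computable.unpair.comp Computable.snd))
        (Computable.snd.comp
          (Computable.unpair.comp (Computable.fst.comp Computable.fst)))).to₂
  have hgc : Partrec₂ fun c n => g (Nat.pair c n) :=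
    hg.comp (Primrec₂.natPair.to_comp.comp Computable.fst Computable.snd)
  obtain ⟨h₁, hc₁, hh₁⟩ := exists_phi_eq hgc
  obtain ⟨h₂, hc₂, hh₂⟩ := exists_phi_eq
    (f := fun c n => (g (Nat.pair c n)).bind fun k =>
      (phi c k).bind fun s => phi s.unpair.2 n) <| by
      refine Partrec.bind hgc (Partrec.bind
        (phi_partrec.comp (Computable.fst.comp Computable.fst) Computable.snd) ?_)
      exact (phi_partrec.comp
        (Computable.snd.comp (Computable.unpair.comp Computable.snd))
        (Computable.snd.comp (Computable.fst.comp Computable.fst))).to₂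
  refine ⟨fun c => Part.some (Nat.pair (h₁ c) (h₂ c)),
    Partrec.nat_iff.1 (Primrec₂.natPair.to_comp.comp hc₁ hc₂), fun c s A hs hA => ?_⟩
  have hphi : ∀ k, phi c k = Part.some (s k) := fun k => Part.eq_some_iff.2 (hs k)
  have hgs' : ∀ n, (∀ k ∈ g (Nat.pair c n), (phi (s k).unpair.1 n).Dom) ∧
      ((∃ k, (phi (s k).unpair.1 n).Dom) → (g (Nat.pair c n)).Dom) := fun n => by
    simpa [hphi] using hgs (Nat.pair c n)
  have key : ∀ n x, x ∈ ν n → ((g (Nat.pair c n)).Dom ↔ x ∈ ⋃ k, A k) := fun n x hx => by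
    refine ⟨fun h => ?_, fun h => ?_⟩
    · exact Set.mem_iUnion.2 ⟨_, ((hA _).1 n x hx).1 ((hgs' n).1 _ (Part.get_mem h))⟩
    · obtain ⟨k, hk⟩ := Set.mem_iUnion.1 h
      exact (hgs' n).2 ⟨k, ((hA k).1 n x hx).2 hk⟩
  refine ⟨_, Part.mem_some _, fun n x hx => ?_, fun n x hx hxA => ?_⟩
  · simpa [hh₁] using key n x hx
  · obtain ⟨k, hk⟩ := Part.dom_iff_mem.1 ((key n x hx).2 hxA)
    have hxk : x ∈ A k := ((hA k).1 n x hx).1 ((hgs' n).1 k hk)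
    obtain ⟨b, hb, B, hB, hxB, hBA⟩ := (hA k).2 n x hx hxk
    refine ⟨b, ?_, B, hB, hxB, hBA.trans (Set.subset_iUnion A k)⟩
    rw [Nat.unpair_pair, hh₂]
    exact Part.mem_bind hk (by rw [hphi, Part.bind_some]; exact hb)

theorem IsNoginaBasis.exists_name_inter (hβ : IsNoginaBasis ν β) :
    ∃ I : ℕ →. ℕ, Nat.Partrec I ∧
      ∀ n₁ n₂ A₁ A₂, NoginaName ν β n₁ A₁ → NoginaName ν β n₂ A₂ →
        ∃ u ∈ I (Nat.pair n₁ n₂), NoginaName ν β u (A₁ ∩ A₂) := by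
  obtain ⟨H, hH, hHp⟩ := hβ.inter
  obtain ⟨h₁, hc₁, hh₁⟩ := exists_phi_eq
    (f := fun a n => (phi a.unpair.1.unpair.1 n).bind fun _ => phi a.unpair.2.unpair.1 n) <| by
      refine Partrec.bind (phi_partrec.comp (Computable.fst.comp (Computable.unpair.comp
        (Computable.fst.comp (Computable.unpair.comp Computable.fst)))) Computable.snd) ?_
      exact (phi_partrec.comp (Computable.fst.comp (Computable.unpair.comp
        (Computable.snd.comp (Computable.unpair.comp (Computable.fst.comp Computable.fst)))))
        (Computable.snd.comp Computable.fst)).to₂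
  obtain ⟨h₂, hc₂, hh₂⟩ := exists_phi_eq
    (f := fun a n => (phi a.unpair.1.unpair.2 n).bind fun b₁ =>
      (phi a.unpair.2.unpair.2 n).bind fun b₂ => H (Nat.pair (Nat.pair b₁ b₂) n)) <| by
      refine Partrec.bind (phi_partrec.comp (Computable.snd.comp (Computable.unpair.comp
        (Computable.fst.comp (Computable.unpair.comp Computable.fst)))) Computable.snd)
        (Partrec.bind (phi_partrec.comp (Computable.snd.comp (Computable.unpair.comp
          (Computable.snd.comp (Computable.unpair.comp (Computable.fst.comp Computable.fst)))))
          (Computable.snd.comp Computable.fst)) ?_)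
      exact ((Partrec.nat_iff.2 hH).comp (Primrec₂.natPair.to_comp.comp
        (Primrec₂.natPair.to_comp.comp (Computable.snd.comp Computable.fst) Computable.snd)
        (Computable.snd.comp (Computable.fst.comp Computable.fst)))).to₂
  refine ⟨fun a => Part.some (Nat.pair (h₁ a) (h₂ a)),
    Partrec.nat_iff.1 (Primrec₂.natPair.to_comp.comp hc₁ hc₂),
    fun n₁ n₂ A₁ A₂ hA₁ hA₂ => ⟨_, Part.mem_some _, fun n x hx => ?_, ?_⟩⟩
  · rw [Nat.unpair_pair, hh₁, Nat.unpair_pair, Part.bind_dom, exists_prop,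
      hA₁.1 n x hx, hA₂.1 n x hx, Set.mem_inter_iff]
  · rintro n x hx ⟨hx₁, hx₂⟩
    obtain ⟨b₁, hb₁, B₁, hB₁, hxB₁, hBA₁⟩ := hA₁.2 n x hx hx₁
    obtain ⟨b₂, hb₂, B₂, hB₂, hxB₂, hBA₂⟩ := hA₂.2 n x hx hx₂
    obtain ⟨b, hb, B, hB, hxB, hBB⟩ := hHp b₁ b₂ B₁ B₂ n x hB₁ hB₂ hx hxB₁ hxB₂
    refine ⟨b, ?_, B, hB, hxB, hBB.trans (Set.inter_subset_inter hBA₁ hBA₂)⟩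
    rw [Nat.unpair_pair, hh₂, Nat.unpair_pair]
    exact Part.mem_bind hb₁ (Part.mem_bind hb₂ hb)

end Nogina

/-- If `ν` is a numbering of `X` (onto) and `(ℬ, β)` is a Nogina
basis for `(X, ν)`, then the associated Nogina topology, with the actual inclusion
as formal inclusion, is a Type 1 computable topological space. -/
theorem nogina_topology_isCTS {X : Type*} (ν : ℕ →. X) (hν : ∀ x : X, ∃ n, x ∈ ν n)
    (β : ℕ → Set X → Prop) (hβ : IsNoginaBasis ν β) :
    IsCTSIncl ν (TopologicalSpace.generateFrom {B | ∃ b, β b B}) (NoginaName ν β) := by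
  exact {
    single _ _ _ hA hB := (hA.1.subset hν hB.1).antisymm (hB.1.subset hν hA.1)
    isOpen _ _ h := h.isOpen hν
    generates := by
      refine le_antisymm (le_generateFrom ?_) (le_generateFrom ?_)
      · rintro A ⟨_, hA⟩
        exact hA.isOpen hν
      · rintro B ⟨_, hB⟩
        exact TopologicalSpace.isOpen_generateFrom_of_mem (hβ.exists_name_of_basic hB)
    empty := exists_noginaName_empty ν β
    univ := hβ.exists_name_univ
    malcev := ⟨_, Nat.Partrec.left, fun _ _ h => ⟨_, Part.mem_some _, h.1⟩⟩
    union := exists_noginaName_iUnion ν β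
    inter := hβ.exists_name_inter }

end T1
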